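/- Let d ≥ 1 and let g be a d×d real matrix. Let S ⊆ H be a connected set such that (g.mulVec x) 0 ≠ 0 for every x ∈ S, and let S' = {((g.mulVec x) 0)⁻¹ • (g.mulVec x) | x ∈ S}. Then for every y ∈ convexHull ℝ S one has (g.mulVec y) 0 ≠ 0 and ((g.mulVec y) 0)⁻¹ • (g.mulVec y) ∈ convexHull ℝ S'. (This is the key computation in the proof of Proposition 3.2: the projectivization of a linear map carries the convex hull of a connected set lying in an affine chart, whose image also lies in the chart, into the convex hull of the image.) -/

import Mathlib

/-- The part of the preimage of a convex set under the perspective map `y ↦ (φ y)⁻¹ • L y`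
on which `φ` is positive is convex. -/
theorem convex_pos_inv_smul_mem {E F : Type*} [AddCommGroup E] [Module ℝ E] [AddCommGroup F]
    [Module ℝ F] (L : E →ₗ[ℝ] F) (φ : E →ₗ[ℝ] ℝ) {C : Set F} (hC : Convex ℝ C) :
    Convex ℝ {y : E | 0 < φ y ∧ (φ y)⁻¹ • L y ∈ C} := by
  rintro x ⟨hx, hxC⟩ y ⟨hy, hyC⟩ a b ha hb hab
  have hs : 0 < a * φ x + b * φ y := by
    rcases ha.eq_or_lt with rfl | ha'
    · obtain rfl : b = 1 := by linarith
      simpa using hy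
    · positivity
  simp only [Set.mem_ofPred_eq, map_add, map_smul, smul_eq_mul]
  refine ⟨hs, ?_⟩
  convert hC hxC hyC (a := a * φ x / (a * φ x + b * φ y)) (b := b * φ y / (a * φ x + b * φ y))
    (by positivity) (by positivity) (by field_simp) using 1
  rw [smul_add, smul_smul, smul_smul, smul_smul, smul_smul]
  congr 2 <;> field_simp

/-- A perspective map whose denominator is positive on `S` carries the convex hull of `S` into
the convex hull of the image of `S`. -/
theorem inv_smul_mem_convexHull_of_pos {E F : Type*} [AddCommGroup E] [Module ℝ E]
    [AddCommGroup F] [Module ℝ F] (L : E →ₗ[ℝ] F) (φ : E →ₗ[ℝ] ℝ) {S : Set E}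
    (hS : ∀ x ∈ S, 0 < φ x) {y : E} (hy : y ∈ convexHull ℝ S) :
    0 < φ y ∧ (φ y)⁻¹ • L y ∈ convexHull ℝ {z : F | ∃ x ∈ S, z = (φ x)⁻¹ • L x} := by
  have hconv := convex_pos_inv_smul_mem L φ
    (convex_convexHull ℝ {z : F | ∃ x ∈ S, z = (φ x)⁻¹ • L x})
  have hsub : S ⊆ {y | 0 < φ y ∧
      (φ y)⁻¹ • L y ∈ convexHull ℝ {z : F | ∃ x ∈ S, z = (φ x)⁻¹ • L x}} :=
    fun x hx => ⟨hS x hx, subset_convexHull ℝ _ ⟨x, hx, rfl⟩⟩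
  exact convexHull_min hsub hconv hy

/-- A continuous real function without zeros on a preconnected set has constant sign there. -/
theorem IsPreconnected.forall_pos_or_forall_neg {X : Type*} [TopologicalSpace X] {S : Set X}
    (hS : IsPreconnected S) {f : X → ℝ} (hf : ContinuousOn f S) (h0 : ∀ x ∈ S, f x ≠ 0) :
    (∀ x ∈ S, 0 < f x) ∨ ∀ x ∈ S, f x < 0 := by
  by_contra! h
  obtain ⟨⟨a, ha, hfa⟩, b, hb, hfb⟩ := h
  obtain ⟨c, hc, hfc⟩ := hS.intermediate_value ha hb hf ⟨hfa, hfb⟩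
  exact h0 c hc hfc

/-- Key computation in the proof of Proposition 3.2: the projectivization of a
linear map carries the convex hull of a connected set lying in the affine chart
`H = {x | x ⟨0, hd⟩ = 1}`, whose image also lies in the chart, into the convex hull of
its image. -/
theorem stmt1 (d : ℕ) (hd : 1 ≤ d) (g : Matrix (Fin d) (Fin d) ℝ)
    (S : Set (Fin d → ℝ)) (hSH : S ⊆ {x : Fin d → ℝ | x ⟨0, hd⟩ = 1})
    (hconn : IsConnected S)
    (hg : ∀ x ∈ S, (g.mulVec x) ⟨0, hd⟩ ≠ 0) :
    ∀ y ∈ convexHull ℝ S, (g.mulVec y) ⟨0, hd⟩ ≠ 0 ∧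
      ((g.mulVec y) ⟨0, hd⟩)⁻¹ • g.mulVec y ∈
        convexHull ℝ {z : Fin d → ℝ | ∃ x ∈ S, z = ((g.mulVec x) ⟨0, hd⟩)⁻¹ • g.mulVec x} := by
  intro y hy
  let φ : (Fin d → ℝ) →ₗ[ℝ] ℝ := LinearMap.proj ⟨0, hd⟩ ∘ₗ g.mulVecLin
  have hφ : Continuous φ := φ.continuous_of_finiteDimensional
  rcases hconn.isPreconnected.forall_pos_or_forall_neg hφ.continuousOn hg with h | h
  · have := inv_smul_mem_convexHull_of_pos g.mulVecLin φ h hy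
    exact ⟨this.1.ne', this.2⟩
  · have := inv_smul_mem_convexHull_of_pos (-g.mulVecLin) (-φ)
      (fun x hx => neg_pos.2 (h x hx)) hy
    simp only [LinearMap.neg_apply, inv_neg, neg_smul_neg, neg_pos] at this
    exact ⟨this.1.ne, this.2⟩
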